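/- Let f_1, f_2 ∈ B_6 and let f = f_1||f_2 ∈ B_7. If nl_2(f) > 40, then for every integer k and for each choice of distinct indices i, j ∈ {1,2}, Fh_{f_i}(k) ⊆ ∪_{m ≥ 41−k} Fh_{f_j}(m); equivalently, every homogeneous quadratic g with nl(f_i + g) = k satisfies nl(f_j + g) ≥ 41 − k. -/

import Mathlib

open scoped BigOperators

/-- Boolean functions in `n` variables. -/
abbrev BF (n : ℕ) := (Fin n → ZMod 2) → ZMod 2

/-- Hamming distance between two Boolean functions. -/
def hd {n : ℕ} (f g : BF n) : ℕ :=
  (Finset.univ.filter (fun x : Fin n → ZMod 2 => f x ≠ g x)).card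

/-- The Reed--Muller code `RM(r,n)`: Boolean functions given by evaluation of a
multivariate polynomial over `F_2` of total degree at most `r`. -/
def RM (r n : ℕ) : Set (BF n) :=
  {f | ∃ p : MvPolynomial (Fin n) (ZMod 2),
    p.totalDegree ≤ r ∧ ∀ x, f x = MvPolynomial.eval x p}

/-- The `r`-th order nonlinearity of a Boolean function. -/
noncomputable def nl (r : ℕ) {n : ℕ} (f : BF n) : ℕ :=
  sInf {d | ∃ g ∈ RM r n, d = hd f g}

/-- Concatenation `f1 || f2` of two Boolean functions. -/
def concat {n : ℕ} (f1 f2 : BF n) : BF (n + 1) :=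
  fun x => (1 + x (Fin.last n)) * f1 (x ∘ Fin.castSucc)
    + x (Fin.last n) * f2 (x ∘ Fin.castSucc)

/-- A Boolean function is homogeneous quadratic if it is of the form
`∑_{i<j} a_{ij} x_i x_j`. -/
def HomQuad {n : ℕ} (g : BF n) : Prop :=
  ∃ a : Fin n → Fin n → ZMod 2,
    ∀ x, g x = ∑ i : Fin n, ∑ j : Fin n, (if i < j then a i j * x i * x j else 0)

/-- `Fh f r` is the set of homogeneous quadratic functions `g` with `nl(f+g) = r`. -/
def Fh {n : ℕ} (f : BF n) (r : ℕ) : Set (BF n) :=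
  {g | HomQuad g ∧ nl 1 (f + g) = r}

/-- `NFh f r = |Fh f r|`. -/
noncomputable def NFh {n : ℕ} (f : BF n) (r : ℕ) : ℕ := (Fh f r).ncard

/-- The set of 6-variable Boolean functions with nonlinearity 16. -/
def S16 : Set (BF 6) := {f | nl 1 f = 16}

/-- `f1` and `f2` are affine equivalent modulo `RM(r,n)`. -/
def AffEquivMod (r n : ℕ) (f1 f2 : BF n) : Prop :=
  ∃ A : Matrix (Fin n) (Fin n) (ZMod 2), IsUnit A ∧ ∃ b : Fin n → ZMod 2,
    (fun x => f1 x + f2 (A.mulVec x + b)) ∈ RM r n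

def fun1 : BF 6 := fun x => x 0*x 1*x 5 + x 0*x 2*x 4 + x 1*x 2*x 3

def fun2 : BF 6 := fun x => x 0*x 1*x 2*x 3 + x 0*x 1*x 5 + x 0*x 3*x 4 + x 1*x 2*x 4

def fun3 : BF 6 := fun x => x 0*x 1*x 2*x 3 + x 0*x 2*x 4 + x 0*x 3*x 5 + x 1*x 2*x 4
  + x 1*x 2*x 5 + x 1*x 3*x 4

def fun4 : BF 6 := fun x => x 0*x 1*x 2*x 5 + x 0*x 1*x 3*x 4 + x 0*x 2*x 4
  + x 0*x 3*x 4 + x 0*x 3*x 5 + x 1*x 2*x 3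

def fun5 : BF 6 := fun x => x 0*x 1*x 2*x 3*x 4 + x 0*x 2*x 4 + x 0*x 3*x 5
  + x 1*x 2*x 4 + x 1*x 2*x 5 + x 1*x 3*x 4

def fun6 : BF 6 := fun x => x 0*x 1*x 2*x 3*x 4*x 5 + x 0*x 1*x 5 + x 0*x 2*x 4
  + x 1*x 2*x 3

def fun7 : BF 6 := fun x => x 0*x 1*x 2*x 3*x 4*x 5 + x 0*x 1*x 2*x 3 + x 0*x 1*x 5
  + x 0*x 3*x 4 + x 1*x 2*x 4 + x 3*x 4

def fun8 : BF 6 := fun x => x 0*x 1*x 2*x 3*x 4*x 5 + x 0*x 1*x 2*x 3 + x 0*x 2*x 4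
  + x 0*x 3*x 5 + x 1*x 2*x 4 + x 1*x 2*x 5 + x 1*x 3*x 4

def fun9 : BF 6 := fun x => x 0*x 1*x 2*x 3*x 4*x 5 + x 0*x 1*x 2*x 5 + x 0*x 1*x 3*x 4
  + x 0*x 2*x 4 + x 0*x 3*x 4 + x 0*x 3*x 5 + x 1*x 2*x 3 + x 3*x 5

def fun10 : BF 6 := fun x => x 0*x 1*x 2*x 3*x 4*x 5 + x 0*x 1*x 2*x 3 + x 0*x 2*x 3
  + x 0*x 4*x 5 + x 1*x 2*x 3 + x 1*x 2*x 5 + x 1*x 3*x 4 + x 2*x 3 + x 2*x 5 + x 3*x 4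

def fun11 : BF 6 := fun x => x 0*x 1*x 2*x 3*x 4*x 5 + x 0*x 1*x 2*x 5 + x 0*x 1*x 3*x 4
  + x 0*x 2*x 4 + x 0*x 3*x 4 + x 0*x 3*x 5 + x 1*x 2*x 3 + x 1*x 2*x 5 + x 1*x 3*x 4
  + x 2*x 4 + x 3*x 4 + x 3*x 5

def fun12 : BF 6 := fun x => x 0*x 1*x 2*x 3*x 4*x 5 + x 1*x 2*x 3*x 4 + x 0*x 1*x 4*x 5
  + x 0*x 2*x 3*x 5 + x 0*x 1*x 3 + x 0*x 1*x 4 + x 1*x 2*x 4 + x 2*x 3*x 4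
  + x 0*x 1*x 5 + x 2*x 3*x 5

def g0 : BF 6 := fun x => x 0*x 1*x 2 + x 0*x 3*x 4 + x 1*x 3*x 5 + x 2*x 4*x 5
  + x 3*x 4*x 5

theorem exists_mem_RM_hd_eq_nl (r : ℕ) {n : ℕ} (f : BF n) : ∃ g ∈ RM r n, nl r f = hd f g :=
  Nat.sInf_mem (s := {d | ∃ g ∈ RM r n, d = hd f g}) ⟨_, 0, ⟨0, by simp, by simp⟩, rfl⟩

theorem nl_le_hd {r n : ℕ} (f : BF n) {g : BF n} (hg : g ∈ RM r n) : nl r f ≤ hd f g :=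
  Nat.sInf_le ⟨g, hg, rfl⟩

theorem hd_add_right {n : ℕ} (f g l : BF n) : hd f (g + l) = hd (f + g) l := by
  unfold hd
  congr 1
  ext x
  have key : ∀ a b c : ZMod 2, a ≠ b + c ↔ a + b ≠ c := by decide
  simpa using key (f x) (g x) (l x)

theorem hd_concat {n : ℕ} (f1 f2 g1 g2 : BF n) :
    hd (concat f1 f2) (concat g1 g2) = hd f1 g1 + hd f2 g2 := by
  have hsnoc : ∀ (x : Fin n → ZMod 2) (a : ZMod 2),
      (Fin.snoc x a : Fin (n + 1) → ZMod 2) ∘ Fin.castSucc = x := fun x a => by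
    funext i
    simp
  have hone : (1 + 1 : ZMod 2) = 0 := by decide
  simp only [hd, Finset.card_filter]
  rw [← (Fin.snocEquiv fun _ : Fin (n + 1) => ZMod 2).sum_comp, Fintype.sum_prod_type]
  change ∑ a : Fin 2, _ = _
  rw [Fin.sum_univ_two]
  congr 1 <;> refine Finset.sum_congr rfl fun x _ => ?_
  · change (if concat f1 f2 (Fin.snoc x (0 : ZMod 2)) ≠ concat g1 g2 (Fin.snoc x (0 : ZMod 2))
      then 1 else 0) = _
    simp only [concat, Fin.snoc_last, hsnoc]
    simp
  · change (if concat f1 f2 (Fin.snoc x (1 : ZMod 2)) ≠ concat g1 g2 (Fin.snoc x (1 : ZMod 2))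
      then 1 else 0) = _
    simp only [concat, Fin.snoc_last, hsnoc, hone]
    simp

open MvPolynomial in
theorem HomQuad.mem_RM {n : ℕ} {g : BF n} (hg : HomQuad g) : g ∈ RM 2 n := by
  obtain ⟨a, ha⟩ := hg
  refine ⟨∑ i, ∑ j, if i < j then C (a i j) * X i * X j else 0, ?_, fun x => ?_⟩
  · refine totalDegree_finsetSum_le fun i _ => totalDegree_finsetSum_le fun j _ => ?_
    split_ifs
    · refine (totalDegree_mul _ _).trans ?_
      have := totalDegree_mul (C (a i j)) (X i : MvPolynomial (Fin n) (ZMod 2))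
      simp only [totalDegree_C, totalDegree_X] at this ⊢
      omega
    · simp
  · rw [ha, map_sum]
    refine Finset.sum_congr rfl fun i _ => ?_
    rw [map_sum]
    refine Finset.sum_congr rfl fun j _ => ?_
    split_ifs <;> simp

open MvPolynomial in
theorem concat_add_mem_RM {r n : ℕ} {g l1 l2 : BF n} (hg : g ∈ RM (r + 1) n)
    (h1 : l1 ∈ RM r n) (h2 : l2 ∈ RM r n) : concat (g + l1) (g + l2) ∈ RM (r + 1) (n + 1) := by
  obtain ⟨p, hp, hpe⟩ := hg
  obtain ⟨q1, hq1, hq1e⟩ := h1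
  obtain ⟨q2, hq2, hq2e⟩ := h2
  refine ⟨rename Fin.castSucc p + rename Fin.castSucc q1
    + X (Fin.last n) * rename Fin.castSucc (q1 + q2), ?_, fun x => ?_⟩
  · refine (totalDegree_add _ _).trans (max_le ((totalDegree_add _ _).trans (max_le ?_ ?_)) ?_)
    · exact (totalDegree_rename_le _ _).trans hp
    · exact (totalDegree_rename_le _ _).trans (by omega)
    · refine (totalDegree_mul _ _).trans ?_
      have := totalDegree_rename_le (Fin.castSucc : Fin n → Fin (n + 1)) (q1 + q2)
      have := (totalDegree_add q1 q2).trans (max_le hq1 hq2)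
      rw [totalDegree_X]
      omega
  · simp only [concat, Pi.add_apply, hpe, hq1e, hq2e, map_add, map_mul, eval_rename, eval_X]
    generalize x (Fin.last n) = t
    generalize eval (x ∘ Fin.castSucc) p = a
    generalize eval (x ∘ Fin.castSucc) q1 = b
    generalize eval (x ∘ Fin.castSucc) q2 = c
    revert t a b c
    decide

theorem nl_concat_le {n : ℕ} (f1 f2 : BF n) {g : BF n} (hg : HomQuad g) :
    nl 2 (concat f1 f2) ≤ nl 1 (f1 + g) + nl 1 (f2 + g) := by
  obtain ⟨l1, h1, e1⟩ := exists_mem_RM_hd_eq_nl 1 (f1 + g)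
  obtain ⟨l2, h2, e2⟩ := exists_mem_RM_hd_eq_nl 1 (f2 + g)
  rw [e1, e2, ← hd_add_right, ← hd_add_right, ← hd_concat]
  exact nl_le_hd _ (concat_add_mem_RM hg.mem_RM h1 h2)

/-- If `nl_2(f1||f2) > 40`, then `Fh_{f_i}(k) ⊆ ∪_{m ≥ 41-k} Fh_{f_j}(m)`
for distinct `i, j ∈ {1,2}`. -/
theorem stmt12 (f1 f2 : BF 6) (h : 40 < nl 2 (concat f1 f2)) (k : ℕ) :
    (Fh f1 k ⊆ ⋃ m ∈ Set.Ici (41 - k), Fh f2 m) ∧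
    (Fh f2 k ⊆ ⋃ m ∈ Set.Ici (41 - k), Fh f1 m) := by
  constructor <;> rintro g ⟨hg, hk⟩ <;> have := nl_concat_le f1 f2 hg
  · exact Set.mem_biUnion (x := nl 1 (f2 + g)) (Set.mem_Ici.2 (by omega)) ⟨hg, rfl⟩
  · exact Set.mem_biUnion (x := nl 1 (f1 + g)) (Set.mem_Ici.2 (by omega)) ⟨hg, rfl⟩
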